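/- arXiv:2309.04273 — 3 statements merged into one kernel-verified Lean document; each statement's English description precedes it below -/
import Mathlib

section
/- Let R be a finite ring with identity, G ≤ Sym({1,…,n}) a finite permutation group acting on V = R^n by coordinate permutation, and H ≤ G a subgroup whose order |H| is invertible in R. If C ⊆ V is a left G-code, then ⊥(Cθ_H) = ker θ_H ⊕ (⊥C)θ_H; that is, ⊥(Cθ_H) = ker θ_H + (⊥C)θ_H and ker θ_H ∩ (⊥C)θ_H = {0}. -/
open scoped BigOperators

/-- Coordinate-permutation action: `(v · g) i = v (g⁻¹ i)`. -/
def pAct {α : Type} {n : ℕ} (g : Equiv.Perm (Fin n)) (v : Fin n → α) : Fin n → α :=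
  fun i => v (g⁻¹ i)

/-- Hayden's operator `θ_H`: `v θ_H = |H|⁻¹ ∑_{h ∈ H} v h`. -/
noncomputable def theta {R : Type} [Ring R] {n : ℕ} (H : Subgroup (Equiv.Perm (Fin n)))
    (v : Fin n → R) : Fin n → R :=
  fun i => Ring.inverse ((Nat.card H : R)) * ∑ᶠ h ∈ (H : Set (Equiv.Perm (Fin n))), v (h⁻¹ i)

/-- The left dual of a set of vectors in `R^n`. -/
def leftDual {R : Type} [Ring R] {n : ℕ} (S : Set (Fin n → R)) : Set (Fin n → R) :=
  {u | ∀ v ∈ S, ∑ i, u i * v i = 0}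

section Theta

variable {R : Type} [Ring R] {n : ℕ} (H : Subgroup (Equiv.Perm (Fin n)))

theorem theta_apply [Fintype H] (v : Fin n → R) (i : Fin n) :
    theta H v i = Ring.inverse (Nat.card H : R) * ∑ h : H, v ((h : Equiv.Perm (Fin n))⁻¹ i) := by
  rw [theta, finsum_mem_eq_finite_toFinset_sum _ (Set.toFinite _)]
  congr 1
  exact Finset.sum_subtype _ (by simp) _

theorem theta_add (u v : Fin n → R) : theta H (u + v) = theta H u + theta H v := by
  have := Fintype.ofFinite H
  ext i
  simp [theta_apply, Finset.sum_add_distrib, mul_add]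

theorem theta_sub (u v : Fin n → R) : theta H (u - v) = theta H u - theta H v := by
  rw [eq_sub_iff_add_eq, ← theta_add, sub_add_cancel]

theorem theta_zero : theta H (0 : Fin n → R) = 0 := by
  simpa using theta_sub H (0 : Fin n → R) 0

theorem theta_apply_perm (v : Fin n → R) {g : Equiv.Perm (Fin n)} (hg : g ∈ H) (i : Fin n) :
    theta H v (g i) = theta H v i := by
  have := Fintype.ofFinite H
  rw [theta_apply, theta_apply]
  congr 1
  refine Fintype.sum_equiv (Equiv.mulLeft (⟨g, hg⟩⁻¹ : H)) _ _ fun h => ?_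
  simp

theorem theta_theta (hH : IsUnit (Nat.card H : R)) (v : Fin n → R) :
    theta H (theta H v) = theta H v := by
  have := Fintype.ofFinite H
  ext i
  rw [theta_apply]
  simp_rw [fun h : H => theta_apply_perm H v (H.inv_mem h.2) i]
  rw [Finset.sum_const, Finset.card_univ, nsmul_eq_mul, ← Nat.card_eq_fintype_card, ← mul_assoc,
    Ring.inverse_mul_cancel _ hH, one_mul]

theorem sum_theta_mul (u v : Fin n → R) :
    ∑ i, theta H u i * v i = ∑ i, u i * theta H v i := by
  have := Fintype.ofFinite H
  have hk (x : R) : x * Ring.inverse (Nat.card H : R) = Ring.inverse (Nat.card H : R) * x := by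
    by_cases hH : IsUnit (Nat.card H : R)
    · obtain ⟨k, hk⟩ := hH
      rw [← hk, Ring.inverse_unit]
      exact (Commute.units_inv_left (hk ▸ Nat.cast_commute (Nat.card H) x)).symm.eq
    · rw [Ring.inverse_non_unit _ hH, mul_zero, zero_mul]
  simp only [theta_apply, ← mul_assoc, hk]
  simp only [mul_assoc, ← Finset.mul_sum]
  congr 1
  simp only [Finset.sum_mul, Finset.mul_sum]
  rw [Finset.sum_comm, Finset.sum_comm (s := Finset.univ (α := Fin n))]
  refine Fintype.sum_equiv (Equiv.inv H) _ _ fun h => ?_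
  refine Fintype.sum_equiv (h : Equiv.Perm (Fin n))⁻¹ _ _ fun i => ?_
  simp

theorem theta_mem (C : Submodule R (Fin n → R)) (hC : ∀ c ∈ C, ∀ g ∈ H, pAct g c ∈ C)
    {c : Fin n → R} (hc : c ∈ C) : theta H c ∈ C := by
  have := Fintype.ofFinite H
  have h : theta H c =
      Ring.inverse (Nat.card H : R) • ∑ h : H, pAct (h : Equiv.Perm (Fin n)) c := by
    ext i
    simp [theta_apply, pAct]
  rw [h]
  exact C.smul_mem _ (C.sum_mem fun g _ => hC c hc g g.2)

theorem theta_mem_leftDual_iff (S : Set (Fin n → R)) (u : Fin n → R) :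
    theta H u ∈ leftDual S ↔ u ∈ leftDual (theta H '' S) := by
  simp [leftDual, sum_theta_mul]

end Theta

/-- Hayden's theorem for `G`-codes over finite Frobenius rings:
`⊥(Cθ_H) = ker θ_H ⊕ (⊥C)θ_H`. -/
theorem stmt1 {n : ℕ} {R : Type} [Ring R] [Fintype R]
    (G H : Subgroup (Equiv.Perm (Fin n))) (hHG : H ≤ G)
    (hH : IsUnit ((Nat.card H : R)))
    (C : Submodule R (Fin n → R))
    (hC : ∀ c ∈ C, ∀ g ∈ G, pAct g c ∈ C) :
    leftDual (theta (R := R) H '' (C : Set (Fin n → R)))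
        = {w | ∃ a ∈ {v : Fin n → R | theta (R := R) H v = 0},
               ∃ b ∈ theta (R := R) H '' leftDual (C : Set (Fin n → R)), w = a + b}
      ∧ {v : Fin n → R | theta (R := R) H v = 0}
          ∩ (theta (R := R) H '' leftDual (C : Set (Fin n → R))) = {0} := by
  constructor
  · ext u
    constructor
    · intro hu
      refine ⟨u - theta H u, ?_, theta H u, ⟨theta H u, ?_, theta_theta H hH u⟩, by simp⟩
      · simp [theta_sub, theta_theta H hH]
      · exact (theta_mem_leftDual_iff H _ u).2 hu
    · rintro ⟨a, ha, _, ⟨b, hb, rfl⟩, rfl⟩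
      rw [← theta_mem_leftDual_iff, theta_add, show theta H a = 0 from ha, zero_add,
        theta_theta H hH, theta_mem_leftDual_iff]
      rintro _ ⟨c, hc, rfl⟩
      exact hb _ (theta_mem H C (fun c hc g hg => hC c hc g (hHG hg)) hc)
  · ext u
    constructor
    · rintro ⟨hu, b, -, rfl⟩
      exact (theta_theta H hH b).symm.trans hu
    · rintro rfl
      exact ⟨theta_zero H, 0, fun v _ => by simp, theta_zero H⟩
end

section
/- Fix an integer k ≥ 2 and a positive integer g, let C ⊆ (ℤ/kℤ)^n be a G-code for a finite permutation group G ≤ Sym({1,…,n}), and let H ≤ G with gcd(|H|, k) = 1 and orbits ω_1,…,ω_t on {1,…,n}. Then for every τ in the Siegel upper half-space ℍ_g: ϑ^{H,(g)}_{Λ_0(C)θ_H}(τ) = cwe_H^{(g)}(Cθ_H : (f_a(τ))_{a∈(ℤ/kℤ)^g}). -/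
open scoped BigOperators

/-- Hayden's operator on `ℝ^n`: `v θ_H = |H|⁻¹ ∑_{h ∈ H} v h`. -/
noncomputable def thetaR {n : ℕ} (H : Subgroup (Equiv.Perm (Fin n)))
    (v : Fin n → ℝ) : Fin n → ℝ :=
  fun i => (Nat.card H : ℝ)⁻¹ * ∑ᶠ h ∈ (H : Set (Equiv.Perm (Fin n))), v (h⁻¹ i)

/-- The mod-`k` Hayden operator on `(ℤ/kℤ)^n`. -/
noncomputable def thetaZ {n : ℕ} (k : ℕ) (H : Subgroup (Equiv.Perm (Fin n)))
    (c : Fin n → ZMod k) : Fin n → ZMod k :=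
  fun i => Ring.inverse ((Nat.card H : ZMod k)) *
    ∑ᶠ h ∈ (H : Set (Equiv.Perm (Fin n))), c (h⁻¹ i)

/-- The orbit of a coordinate `j` under the permutation group `H`. -/
def orbSet {n : ℕ} (H : Subgroup (Equiv.Perm (Fin n))) (j : Fin n) : Set (Fin n) :=
  {m | ∃ h ∈ H, h j = m}

/-- Construction A: `Λ(C) = (1/√k)·{x ∈ ℤ^n : x mod k ∈ C}`. -/
noncomputable def conA {n : ℕ} (k : ℕ) (S : Set (Fin n → ZMod k)) : Set (Fin n → ℝ) :=
  {v | ∃ x : Fin n → ℤ, (fun i => ((x i : ZMod k))) ∈ S ∧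
        v = fun i => (Real.sqrt k)⁻¹ * (x i : ℝ)}

/-- The theta functions `f_a(τ) = ∑_{b ∈ ℤ^g, b ≡ a (mod k)} exp((πi/k)·bᵀτb)`. -/
noncomputable def fA (k g : ℕ) (τ : Matrix (Fin g) (Fin g) ℂ) (a : Fin g → ZMod k) : ℂ :=
  ∑' b : {b : Fin g → ℤ // ∀ j, ((b j : ZMod k)) = a j},
    Complex.exp ((Real.pi : ℂ) * Complex.I / (k : ℂ) *
      ∑ j, ∑ l, ((b : Fin g → ℤ) j : ℂ) * τ j l * ((b : Fin g → ℤ) l : ℂ))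

/-- The genus-`g` `H`-complete weight enumerator of a set of `H`-fixed codewords. -/
noncomputable def cweHg {k : ℕ} {n t : ℕ} (g : ℕ) (rep : Fin t → Fin n)
    (S : Set (Fin n → ZMod k)) (x : (Fin g → ZMod k) → ℂ) : ℂ :=
  ∑ᶠ u ∈ {u : Fin g → (Fin n → ZMod k) | ∀ j, u j ∈ S},
    ∏ i : Fin t, x (fun j => u j (rep i))

/-- A finite product of absolutely convergent series converges absolutely to the product of the
sums. -/
theorem summable_norm_and_tsum_fin_prod {R : Type*} [NormedCommRing R] [CompleteSpace R] :
    ∀ {t : ℕ} {β : Fin t → Type} (f : ∀ i, β i → R) (_ : ∀ i, Summable fun b => ‖f i b‖),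
      (Summable fun b : ∀ i, β i => ‖∏ i, f i (b i)‖) ∧
        ∑' b : ∀ i, β i, ∏ i, f i (b i) = ∏ i, ∑' b, f i b
  | 0, β, f, _ => by
    refine ⟨(hasSum_fintype _).summable, ?_⟩
    rw [tsum_fintype]
    simp
  | t + 1, β, f, hf => by
    obtain ⟨hs, ht⟩ := summable_norm_and_tsum_fin_prod (fun i => f (Fin.succ i))
      fun i => hf (Fin.succ i)
    have key : ∀ p : β 0 × (∀ i : Fin t, β i.succ),
        ∏ i, f i (Fin.consEquiv β p i) = f 0 p.1 * ∏ i : Fin t, f i.succ (p.2 i) := fun p => by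
      rw [Fin.prod_univ_succ]
      rfl
    constructor
    · rw [← (Fin.consEquiv β).summable_iff]
      refine ((hf 0).mul_norm hs).congr fun p => ?_
      rw [Function.comp_apply, key]
    · rw [← (Fin.consEquiv β).tsum_eq, Fin.prod_univ_succ, ← ht,
        tsum_mul_tsum_of_summable_norm (hf 0) hs]
      exact tsum_congr key

theorem tsum_sigma_eq_sum_tsum {E α : Type*} [NormedAddCommGroup E] [CompleteSpace E] [Fintype α]
    {β : α → Type*} {f : ∀ a, β a → E} (hf : ∀ a, Summable fun b => ‖f a b‖) :
    ∑' p : Σ a, β a, f p.1 p.2 = ∑ a, ∑' b, f a b := by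
  have hs : Summable fun p : Σ a, β a => ‖f p.1 p.2‖ :=
    (summable_sigma_of_nonneg fun _ => norm_nonneg _).mpr ⟨hf, (hasSum_fintype _).summable⟩
  rw [hs.of_norm.tsum_sigma' fun a => (hf a).of_norm, tsum_fintype]

theorem Matrix.PosDef.exists_pos_mul_sum_sq_le {g : ℕ} {M : Matrix (Fin g) (Fin g) ℝ}
    (hM : M.PosDef) :
    ∃ c : ℝ, 0 < c ∧ ∀ x : Fin g → ℝ, c * ∑ j, x j ^ 2 ≤ ∑ j, ∑ l, x j * M j l * x l := by
  have hpos : ∀ x : Fin g → ℝ, x ≠ 0 → 0 < ∑ j, ∑ l, x j * M j l * x l := fun x hx => by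
    have h := hM.dotProduct_mulVec_pos hx
    simpa [dotProduct, Matrix.mulVec, Finset.mul_sum, mul_assoc] using h
  rcases (Metric.sphere (0 : Fin g → ℝ) 1).eq_empty_or_nonempty with hS | hS
  · refine ⟨1, one_pos, fun x => ?_⟩
    have hx : x = 0 := by
      by_contra hx
      have : (‖x‖⁻¹ • x) ∈ Metric.sphere (0 : Fin g → ℝ) 1 := by
        simp [norm_smul, hx]
      simp [hS] at this
    simp [hx]
  · obtain ⟨x₀, hx₀, hmin⟩ := (isCompact_sphere (0 : Fin g → ℝ) 1).exists_isMinOn hS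
      (f := fun x => ∑ j, ∑ l, x j * M j l * x l) (by fun_prop)
    have hx₀' : x₀ ≠ 0 := by
      rintro rfl
      simp at hx₀
    set m := ∑ j, ∑ l, x₀ j * M j l * x₀ l with hm
    have hm0 : 0 < m := hpos x₀ hx₀'
    have hg : 0 < (g : ℝ) := by
      rcases Nat.eq_zero_or_pos g with rfl | h
      · exact absurd (Subsingleton.elim _ _) hx₀'
      · exact_mod_cast h
    refine ⟨m / g, div_pos hm0 hg, fun x => ?_⟩
    rcases eq_or_ne x 0 with rfl | hx
    · simp
    have hn : 0 < ‖x‖ := norm_pos_iff.mpr hx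
    have h1 : ∑ j, x j ^ 2 ≤ g * ‖x‖ ^ 2 := by
      calc ∑ j, x j ^ 2 ≤ ∑ _j : Fin g, ‖x‖ ^ 2 := Finset.sum_le_sum fun j _ => by
            rw [← sq_abs]
            exact pow_le_pow_left₀ (abs_nonneg _) (norm_le_pi_norm x j) 2
        _ = g * ‖x‖ ^ 2 := by simp
    have h2 : m ≤ ‖x‖⁻¹ ^ 2 * ∑ j, ∑ l, x j * M j l * x l := by
      have := hmin (show (‖x‖⁻¹ • x) ∈ Metric.sphere (0 : Fin g → ℝ) 1 by
        simp [norm_smul, hx])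
      refine le_trans this (le_of_eq ?_)
      simp only [Finset.mul_sum, Pi.smul_apply, smul_eq_mul]
      exact Finset.sum_congr rfl fun j _ => Finset.sum_congr rfl fun l _ => by ring
    calc m / g * ∑ j, x j ^ 2 ≤ m / g * (g * ‖x‖ ^ 2) := by gcongr
      _ = m * ‖x‖ ^ 2 := by field_simp
      _ ≤ (‖x‖⁻¹ ^ 2 * ∑ j, ∑ l, x j * M j l * x l) * ‖x‖ ^ 2 := by gcongr
      _ = ∑ j, ∑ l, x j * M j l * x l := by field_simp

theorem summable_exp_neg_mul_int_sq {a : ℝ} (ha : 0 < a) :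
    Summable fun m : ℤ => Real.exp (-a * (m : ℝ) ^ 2) := by
  have hτ : 0 < (((a / Real.pi : ℝ) : ℂ) * Complex.I).im := by
    simpa using div_pos ha Real.pi_pos
  refine ((summable_jacobiTheta₂_term_iff 0 _).mpr hτ).norm.congr fun m => ?_
  rw [jacobiTheta₂_term, mul_zero, zero_add, Complex.norm_exp]
  congr 1
  have : (Real.pi : ℂ) * Complex.I * (m : ℂ) ^ 2 * (((a / Real.pi : ℝ) : ℂ) * Complex.I)
      = ((-a * (m : ℝ) ^ 2 : ℝ) : ℂ) := by
    have := Real.pi_ne_zero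
    push_cast
    field_simp
    rw [Complex.I_sq]
    ring
  rw [this, Complex.ofReal_re]

theorem summable_norm_siegel_term {k g : ℕ} (hk : 0 < k) {τ : Matrix (Fin g) (Fin g) ℂ}
    (hpos : (τ.map Complex.im).PosDef) :
    Summable fun b : Fin g → ℤ => ‖Complex.exp ((Real.pi : ℂ) * Complex.I / (k : ℂ) *
      ∑ j, ∑ l, (b j : ℂ) * τ j l * (b l : ℂ))‖ := by
  obtain ⟨c, hc, hle⟩ := hpos.exists_pos_mul_sum_sq_le
  have hk' : (0 : ℝ) < k := by exact_mod_cast hk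
  have ha : 0 < Real.pi / k * c := by positivity
  have hsum := (summable_norm_and_tsum_fin_prod (R := ℝ) (t := g) (β := fun _ => ℤ)
    (fun _ m => Real.exp (-(Real.pi / k * c) * (m : ℝ) ^ 2))
    fun _ => (summable_exp_neg_mul_int_sq ha).norm).1
  refine hsum.of_nonneg_of_le (fun _ => norm_nonneg _) fun b => ?_
  rw [← Real.exp_sum, Real.norm_of_nonneg (Real.exp_pos _).le, Complex.norm_exp,
    Real.exp_le_exp, ← Finset.mul_sum]
  have him : (∑ j, ∑ l, (b j : ℂ) * τ j l * (b l : ℂ)).im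
      = ∑ j, ∑ l, (b j : ℝ) * (τ.map Complex.im) j l * (b l : ℝ) := by
    simp [Complex.im_sum, Complex.mul_im]
  have hre : ((Real.pi : ℂ) * Complex.I / (k : ℂ) *
      ∑ j, ∑ l, (b j : ℂ) * τ j l * (b l : ℂ)).re
      = -(Real.pi / k) * ∑ j, ∑ l, (b j : ℝ) * (τ.map Complex.im) j l * (b l : ℝ) := by
    rw [← him, show (Real.pi : ℂ) * Complex.I / (k : ℂ) = ((Real.pi / k : ℝ) : ℂ) * Complex.I by
      push_cast; ring, mul_assoc, Complex.re_ofReal_mul, Complex.I_mul_re]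
    ring
  rw [hre]
  have := mul_le_mul_of_nonneg_left (hle fun j => (b j : ℝ)) (div_pos Real.pi_pos hk').le
  linarith

theorem finsum_mem_subgroup_perm_apply {n : ℕ} {M : Type*} [AddCommMonoid M]
    (H : Subgroup (Equiv.Perm (Fin n))) {h₀ : Equiv.Perm (Fin n)} (h₀H : h₀ ∈ H)
    (v : Fin n → M) (m : Fin n) :
    ∑ᶠ h ∈ (H : Set (Equiv.Perm (Fin n))), v (h⁻¹ (h₀ m))
      = ∑ᶠ h ∈ (H : Set (Equiv.Perm (Fin n))), v (h⁻¹ m) := by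
  rw [← finsum_set_coe_eq_finsum_mem (f := fun h : Equiv.Perm (Fin n) => v (h⁻¹ (h₀ m))),
    ← finsum_set_coe_eq_finsum_mem (f := fun h : Equiv.Perm (Fin n) => v (h⁻¹ m))]
  refine (finsum_comp_equiv (Equiv.mulLeft (⟨h₀, h₀H⟩ : H))).symm.trans
    (finsum_congr fun h => ?_)
  simp

theorem finsum_mem_subgroup_of_fixed {n : ℕ} {R : Type*} [Semiring R]
    {H : Subgroup (Equiv.Perm (Fin n))} {v : Fin n → R} (hv : ∀ h ∈ H, ∀ m, v (h m) = v m)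
    (m : Fin n) :
    ∑ᶠ h ∈ (H : Set (Equiv.Perm (Fin n))), v (h⁻¹ m) = (Nat.card H : R) * v m := by
  classical
  rw [finsum_mem_congr rfl fun h hh => hv h⁻¹ (H.inv_mem hh) m,
    ← finsum_set_coe_eq_finsum_mem (f := fun _ : Equiv.Perm (Fin n) => v m),
    finsum_eq_sum_of_fintype]
  simp [Nat.card_eq_fintype_card]

theorem thetaZ_apply_perm {n k : ℕ} {H : Subgroup (Equiv.Perm (Fin n))}
    {h₀ : Equiv.Perm (Fin n)} (h₀H : h₀ ∈ H) (c : Fin n → ZMod k) (m : Fin n) :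
    thetaZ k H c (h₀ m) = thetaZ k H c m := by
  rw [thetaZ, thetaZ, finsum_mem_subgroup_perm_apply H h₀H]

theorem thetaR_apply_perm {n : ℕ} {H : Subgroup (Equiv.Perm (Fin n))}
    {h₀ : Equiv.Perm (Fin n)} (h₀H : h₀ ∈ H) (v : Fin n → ℝ) (m : Fin n) :
    thetaR H v (h₀ m) = thetaR H v m := by
  rw [thetaR, thetaR, finsum_mem_subgroup_perm_apply H h₀H]

theorem thetaR_eq_self {n : ℕ} {H : Subgroup (Equiv.Perm (Fin n))} {v : Fin n → ℝ}
    (hv : ∀ h ∈ H, ∀ m, v (h m) = v m) : thetaR H v = v := by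
  funext m
  rw [thetaR, finsum_mem_subgroup_of_fixed hv, inv_mul_cancel_left₀]
  exact_mod_cast Nat.card_pos.ne'

theorem thetaZ_mem {n k : ℕ} {H : Subgroup (Equiv.Perm (Fin n))}
    {C : Submodule (ZMod k) (Fin n → ZMod k)} (hC : ∀ c ∈ C, ∀ h ∈ H, pAct h c ∈ C)
    {c : Fin n → ZMod k} (hc : c ∈ C) : thetaZ k H c ∈ C := by
  have : thetaZ k H c = Ring.inverse (Nat.card H : ZMod k) •
      ∑ᶠ h ∈ (H : Set (Equiv.Perm (Fin n))), pAct h c := by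
    funext m
    rw [Pi.smul_apply, smul_eq_mul, thetaZ]
    exact congrArg _ ((Pi.evalAddMonoidHom (fun _ => ZMod k) m).map_finsum_mem
      (fun h => pAct h c) (Set.toFinite _)).symm
  rw [this]
  exact C.smul_mem _ (finsum_mem_induction (· ∈ C) C.zero_mem (fun _ _ => C.add_mem)
    fun h hh => hC c hc h hh)

/-- Hayden's operator commutes with reduction mod `k` wherever it preserves integrality. -/
theorem thetaZ_intCast_of_thetaR {n k : ℕ} (hk : 0 < k) {H : Subgroup (Equiv.Perm (Fin n))}
    (hgcd : Nat.gcd (Nat.card H) k = 1) {x y : Fin n → ℤ}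
    (hxy : thetaR H (fun i => (Real.sqrt k)⁻¹ * (x i : ℝ))
      = fun i => (Real.sqrt k)⁻¹ * (y i : ℝ)) :
    thetaZ k H (fun i => (x i : ZMod k)) = fun i => (y i : ZMod k) := by
  classical
  have hs : (Real.sqrt k)⁻¹ ≠ 0 := by
    have : (0 : ℝ) < k := by exact_mod_cast hk
    positivity
  have hH : (Nat.card H : ℝ) ≠ 0 := by exact_mod_cast Nat.card_pos.ne'
  have hu : IsUnit (Nat.card H : ZMod k) := (ZMod.isUnit_iff_coprime _ _).mpr hgcd
  funext m
  have h1 := congrFun hxy m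
  simp only [thetaR] at h1
  rw [← finsum_set_coe_eq_finsum_mem
      (f := fun h : Equiv.Perm (Fin n) => (Real.sqrt k)⁻¹ * (x (h⁻¹ m) : ℝ)),
    finsum_eq_sum_of_fintype, ← Finset.mul_sum, mul_left_comm] at h1
  have h2 := mul_left_cancel₀ hs h1
  rw [inv_mul_eq_iff_eq_mul₀ hH] at h2
  have h3 : ∑ h : (H : Set (Equiv.Perm (Fin n))), x ((h : Equiv.Perm (Fin n))⁻¹ m)
      = (Nat.card H : ℤ) * y m := by
    exact_mod_cast h2
  have h4 := congrArg (Int.cast : ℤ → ZMod k) h3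
  push_cast at h4
  rw [thetaZ, ← finsum_set_coe_eq_finsum_mem
      (f := fun h : Equiv.Perm (Fin n) => (x (h⁻¹ m) : ZMod k)),
    finsum_eq_sum_of_fintype]
  refine (congrArg _ h4).trans ?_
  rw [Ring.inverse_mul_cancel_left _ _ hu]

/-- The projected lattice `Λ₀(C)θ_H` consists of the `H`-fixed vectors of Construction A applied
to `Cθ_H`. -/
theorem mem_thetaR_image_iff {n k : ℕ} (hk : 0 < k) {H : Subgroup (Equiv.Perm (Fin n))}
    (hgcd : Nat.gcd (Nat.card H) k = 1) {C : Submodule (ZMod k) (Fin n → ZMod k)}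
    (hC : ∀ c ∈ C, ∀ h ∈ H, pAct h c ∈ C) (w : Fin n → ℝ) :
    w ∈ thetaR H '' {v ∈ conA k (C : Set (Fin n → ZMod k)) |
        thetaR H v ∈ conA k (C : Set (Fin n → ZMod k))} ↔
      ∃ y : Fin n → ℤ, (∀ h ∈ H, ∀ m, y (h m) = y m) ∧
        (fun i => (y i : ZMod k)) ∈ thetaZ k H '' (C : Set (Fin n → ZMod k)) ∧
        w = fun i => (Real.sqrt k)⁻¹ * (y i : ℝ) := by
  have hs : (Real.sqrt k)⁻¹ ≠ 0 := by
    have : (0 : ℝ) < k := by exact_mod_cast hk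
    positivity
  constructor
  · rintro ⟨_, ⟨⟨x, hx, rfl⟩, y, -, hxy⟩, rfl⟩
    refine ⟨y, fun h hh m => ?_, ⟨_, hx, thetaZ_intCast_of_thetaR hk hgcd hxy⟩, hxy⟩
    have := thetaR_apply_perm hh (fun i => (Real.sqrt k)⁻¹ * (x i : ℝ)) m
    rw [hxy] at this
    exact_mod_cast mul_left_cancel₀ hs this
  · rintro ⟨y, hy, ⟨c, hc, hcy⟩, rfl⟩
    have hmem : (fun i => (Real.sqrt k)⁻¹ * (y i : ℝ)) ∈ conA k (C : Set (Fin n → ZMod k)) :=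
      ⟨y, hcy ▸ thetaZ_mem hC hc, rfl⟩
    have hfix : thetaR H (fun i => (Real.sqrt k)⁻¹ * (y i : ℝ))
        = fun i => (Real.sqrt k)⁻¹ * (y i : ℝ) :=
      thetaR_eq_self fun h hh m => by rw [hy h hh m]
    exact ⟨_, ⟨hmem, hfix.symm ▸ hmem⟩, hfix⟩

/-- The exponential of the genus-`g` form of the scaled integral vectors with orbit values `b i`
factors over the orbits. -/
theorem exp_scaled_form_eq_prod {k g t : ℕ} (hk : 0 < k) (τ : Matrix (Fin g) (Fin g) ℂ)
    (b : Fin t → Fin g → ℤ) :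
    Complex.exp ((Real.pi : ℂ) * Complex.I * ∑ j, ∑ l, τ j l *
        ((∑ i : Fin t, ((Real.sqrt k)⁻¹ * (b i l : ℝ)) * ((Real.sqrt k)⁻¹ * (b i j : ℝ)) : ℝ) : ℂ))
      = ∏ i, Complex.exp ((Real.pi : ℂ) * Complex.I / (k : ℂ) *
          ∑ j, ∑ l, (b i j : ℂ) * τ j l * (b i l : ℂ)) := by
  have hkR : (0 : ℝ) < k := by exact_mod_cast hk
  have hsq : ((Real.sqrt k : ℝ) : ℂ)⁻¹ * ((Real.sqrt k : ℝ) : ℂ)⁻¹ = (k : ℂ)⁻¹ := by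
    rw [← mul_inv, ← Complex.ofReal_mul, Real.mul_self_sqrt hkR.le, Complex.ofReal_natCast]
  rw [← Complex.exp_sum, ← Finset.mul_sum, Finset.sum_comm (s := (Finset.univ : Finset (Fin t))),
    div_eq_mul_inv, mul_assoc _ (k : ℂ)⁻¹]
  congr 2
  rw [Finset.mul_sum]
  refine Finset.sum_congr rfl fun j _ => ?_
  rw [Finset.sum_comm, Finset.mul_sum]
  refine Finset.sum_congr rfl fun l _ => ?_
  push_cast
  rw [Finset.mul_sum, Finset.mul_sum]
  refine Finset.sum_congr rfl fun i _ => ?_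
  rw [← hsq]
  ring

/-- Evaluating the weight enumerator at sums over residue classes turns it into one series over
pairs of a tuple of codewords and a choice of integral lifts of its orbit values. -/
theorem cweHg_tsum_eq_tsum_prod {k g n t : ℕ} [NeZero k] (rep : Fin t → Fin n)
    (S : Set (Fin n → ZMod k)) {F : (Fin g → ℤ) → ℂ} (hF : Summable fun b => ‖F b‖) :
    cweHg g rep S (fun a => ∑' b : {b : Fin g → ℤ // ∀ j, (b j : ZMod k) = a j}, F b.1) =
      ∑' p : Σ u : {u : Fin g → (Fin n → ZMod k) // ∀ j, u j ∈ S},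
          ∀ i : Fin t, {b : Fin g → ℤ // ∀ j, (b j : ZMod k) = u.1 j (rep i)},
        ∏ i, F (p.2 i).1 := by
  have := Fintype.ofFinite {u : Fin g → (Fin n → ZMod k) // ∀ j, u j ∈ S}
  have hprod := fun u : {u : Fin g → (Fin n → ZMod k) // ∀ j, u j ∈ S} =>
    summable_norm_and_tsum_fin_prod
      (β := fun i : Fin t => {b : Fin g → ℤ // ∀ j, (b j : ZMod k) = u.1 j (rep i)})
      (fun _ b => F b.1) fun _ => hF.comp_injective Subtype.val_injective
  rw [tsum_sigma_eq_sum_tsum fun u => (hprod u).1, Finset.sum_congr rfl fun u _ => (hprod u).2,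
    cweHg, ← finsum_set_coe_eq_finsum_mem
      (f := fun u : Fin g → (Fin n → ZMod k) => ∏ i : Fin t,
        ∑' b : {b : Fin g → ℤ // ∀ j, (b j : ZMod k) = u j (rep i)}, F b.1)]
  exact finsum_eq_sum_of_fintype (α := {u : Fin g → (Fin n → ZMod k) // ∀ j, u j ∈ S}) _

/-- The genus-`g` `H`-theta series of `Λ₀(C)θ_H` equals the genus-`g`
`H`-equivariant complete weight enumerator of `C` evaluated at the theta
functions `f_a(τ)`, for `τ` in the Siegel upper half-space. -/
theorem stmt13 {n t : ℕ} (k : ℕ) (hk : 2 ≤ k) (g : ℕ) (hg : 0 < g)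
    (G H : Subgroup (Equiv.Perm (Fin n))) (hHG : H ≤ G)
    (hgcd : Nat.gcd (Nat.card H) k = 1)
    (rep : Fin t → Fin n)
    (hrep : ∀ j : Fin n, ∃! i : Fin t, j ∈ orbSet H (rep i))
    (C : Submodule (ZMod k) (Fin n → ZMod k))
    (hC : ∀ c ∈ C, ∀ g' ∈ G, pAct g' c ∈ C)
    (D : Set (Fin n → ℝ))
    (hD : D = thetaR H '' {v ∈ conA k (C : Set (Fin n → ZMod k)) |
        thetaR H v ∈ conA k (C : Set (Fin n → ZMod k))})
    (τ : Matrix (Fin g) (Fin g) ℂ) (hsym : τ.IsSymm)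
    (hpos : (τ.map Complex.im).PosDef) :
    (∑' v : {v : Fin g → (Fin n → ℝ) // ∀ j, v j ∈ D},
        Complex.exp ((Real.pi : ℂ) * Complex.I *
          ∑ j, ∑ l, τ j l *
            ((∑ i : Fin t, (v : Fin g → (Fin n → ℝ)) l (rep i) *
                (v : Fin g → (Fin n → ℝ)) j (rep i) : ℝ) : ℂ)))
      = cweHg g rep (thetaZ k H '' (C : Set (Fin n → ZMod k))) (fA k g τ) := by
  have hk0 : 0 < k := by lia
  have hkR : (0 : ℝ) < k := by exact_mod_cast hk0
  have hs : (Real.sqrt k)⁻¹ ≠ 0 := by positivity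
  have hmemD : ∀ w, w ∈ D ↔ ∃ y : Fin n → ℤ, (∀ h ∈ H, ∀ m, y (h m) = y m) ∧
      (fun i => (y i : ZMod k)) ∈ thetaZ k H '' (C : Set (Fin n → ZMod k)) ∧
      w = fun i => (Real.sqrt k)⁻¹ * (y i : ℝ) := fun w => by
    rw [hD]
    exact mem_thetaR_image_iff hk0 hgcd (fun c hc h hh => hC c hc h (hHG hh)) w
  choose orb horb horb_unique using hrep
  have horb_rep : ∀ i, orb (rep i) = i := fun i =>
    (horb_unique _ i ⟨1, H.one_mem, rfl⟩).symm
  have horb_perm : ∀ h ∈ H, ∀ m, orb (h m) = orb m := fun h hh m => by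
    obtain ⟨h', hh', hm⟩ := horb m
    exact (horb_unique (h m) (orb m)
      ⟨h * h', H.mul_mem hh hh', by rw [Equiv.Perm.mul_apply, hm]⟩).symm
  have hfix : ∀ {α : Type} {v : Fin n → α}, (∀ h ∈ H, ∀ m, v (h m) = v m) →
      ∀ m, v (rep (orb m)) = v m := fun hv m => by
    obtain ⟨h', hh', hm⟩ := horb m
    rw [← hv h' hh', hm]
  let S : Set (Fin n → ZMod k) := thetaZ k H '' (C : Set (Fin n → ZMod k))
  have hSfix : ∀ c ∈ S, ∀ m, c (rep (orb m)) = c m := by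
    rintro _ ⟨c, -, rfl⟩
    exact hfix fun h hh m => thetaZ_apply_perm hh c m
  let U : Type := {u : Fin g → (Fin n → ZMod k) // ∀ j, u j ∈ S}
  let B : U → Fin t → Type := fun u i =>
    {b : Fin g → ℤ // ∀ j, (b j : ZMod k) = u.1 j (rep i)}
  let e : (Σ u : U, ∀ i, B u i) → {v : Fin g → (Fin n → ℝ) // ∀ j, v j ∈ D} := fun p =>
    ⟨fun j m => (Real.sqrt k)⁻¹ * ((p.2 (orb m)).1 j : ℝ), fun j => (hmemD _).mpr
      ⟨fun m => (p.2 (orb m)).1 j, fun h hh m =>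
        congrArg (fun i => (p.2 i).1 j) (horb_perm h hh m), by
        have : (fun m => (((p.2 (orb m)).1 j : ℤ) : ZMod k)) = p.1.1 j := by
          funext m
          rw [(p.2 (orb m)).2 j, hSfix _ (p.1.2 j)]
        rw [this]
        exact p.1.2 j, rfl⟩⟩
  have he_inj : Function.Injective e := by
    rintro ⟨u, b⟩ ⟨u', b'⟩ h
    have hb : ∀ i j, (b i).1 j = (b' i).1 j := fun i j => by
      have h1 := congrFun (congrFun (congrArg Subtype.val h) j) (rep i)
      have h2 : ((b (orb (rep i))).1 j : ℝ) = ((b' (orb (rep i))).1 j : ℝ) :=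
        mul_left_cancel₀ hs h1
      rw [horb_rep] at h2
      exact_mod_cast h2
    obtain rfl : u = u' := by
      refine Subtype.ext (funext fun j => funext fun m => ?_)
      rw [← hSfix _ (u.2 j) m, ← hSfix _ (u'.2 j) m, ← (b (orb m)).2 j, ← (b' (orb m)).2 j, hb]
    congr 1
    exact funext fun i => Subtype.ext (funext fun j => hb i j)
  have he_surj : Function.Surjective e := by
    rintro ⟨v, hv⟩
    choose y hy hyS hvy using fun j => (hmemD _).mp (hv j)
    refine ⟨⟨⟨fun j m => (y j m : ZMod k), hyS⟩, fun i => ⟨fun j => y j (rep i), fun j => rfl⟩⟩,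
      Subtype.ext (funext fun j => funext fun m => ?_)⟩
    change (Real.sqrt k)⁻¹ * (y j (rep (orb m)) : ℝ) = v j m
    rw [hfix (hy j) m, hvy j]
  have : NeZero k := ⟨hk0.ne'⟩
  refine Eq.trans ?_ (cweHg_tsum_eq_tsum_prod rep _ (summable_norm_siegel_term hk0 hpos)).symm
  rw [← (Equiv.ofBijective e ⟨he_inj, he_surj⟩).tsum_eq]
  refine tsum_congr fun p => ?_
  have hval : ∀ j i, (e p).1 j (rep i) = (Real.sqrt k)⁻¹ * ((p.2 i).1 j : ℝ) := fun j i =>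
    congrArg (fun i' => (Real.sqrt k)⁻¹ * ((p.2 i').1 j : ℝ)) (horb_rep i)
  refine Eq.trans ?_ (exp_scaled_form_eq_prod hk0 τ fun i => (p.2 i).1)
  exact congrArg (fun M : Fin g → Fin g → ℝ =>
      Complex.exp ((Real.pi : ℂ) * Complex.I * ∑ j, ∑ l, τ j l * (M j l : ℂ)))
    (funext₂ fun j l => Finset.sum_congr rfl fun i _ => congrArg₂ (· * ·) (hval l i) (hval j i))
end

section
/- Fix an integer k ≥ 2, let C ⊆ (ℤ/kℤ)^n be a G-code for a finite permutation group G ≤ Sym({1,…,n}), let H ≤ G with gcd(|H|, k) = 1 and orbits ω_1,…,ω_t, and let T ⊆ {1,…,t}. Let y_T ∈ ℝ^n be the H-fixed vector with value √k on every coordinate lying in an orbit ω_i with i ∉ T and value 0 elsewhere; then y_T ∈ Λ_0(C)θ_H, and for every τ in the upper half-plane and z ∈ ℂ: CJ^H_{Cθ_H, T}((ψ_a(τ))_{a∈ℤ/kℤ}, (φ_a(τ,z))_{a∈ℤ/kℤ}) = ϑ^H_{Λ_0(C)θ_H, y_T}(τ, z); in particular, this substitution of the complete H-Jacobi polynomial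 is an H-Jacobi theta series. -/
open scoped BigOperators

/-- The complete `H`-Jacobi polynomial of a set of `H`-fixed codewords. -/
noncomputable def cjH {k : ℕ} {n t : ℕ} (rep : Fin t → Fin n)
    (T : Finset (Fin t)) (S : Set (Fin n → ZMod k)) (x y : ZMod k → ℂ) : ℂ :=
  ∑ᶠ u ∈ S, (∏ i ∈ T, x (u (rep i))) * ∏ i ∈ Tᶜ, y (u (rep i))

/-- `ψ_a(τ) = ∑_{b ≡ a (mod k)} exp(πiτb²/k)`. -/
noncomputable def psiA (k : ℕ) (τ : ℂ) (a : ZMod k) : ℂ :=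
  ∑' b : {b : ℤ // (b : ZMod k) = a},
    Complex.exp ((Real.pi : ℂ) * Complex.I * τ * ((b : ℤ) : ℂ) ^ 2 / (k : ℂ))

/-- `φ_a(τ,z) = ∑_{b ≡ a (mod k)} exp(πiτb²/k + 2πizb)`. -/
noncomputable def phiA (k : ℕ) (τ z : ℂ) (a : ZMod k) : ℂ :=
  ∑' b : {b : ℤ // (b : ZMod k) = a},
    Complex.exp ((Real.pi : ℂ) * Complex.I * τ * ((b : ℤ) : ℂ) ^ 2 / (k : ℂ)
      + 2 * (Real.pi : ℂ) * Complex.I * z * ((b : ℤ) : ℂ))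

open Classical in
/-- The `H`-fixed vector with value `√k` on coordinates in orbits `ω_i`, `i ∉ T`,
and `0` elsewhere. -/
noncomputable def yVec {n t : ℕ} (k : ℕ) (H : Subgroup (Equiv.Perm (Fin n)))
    (rep : Fin t → Fin n) (T : Finset (Fin t)) : Fin n → ℝ :=
  fun j => if ∃ i : Fin t, i ∉ T ∧ j ∈ orbSet H (rep i) then Real.sqrt k else 0

theorem summable_norm_and_tsum_pi_prod {t : ℕ} {β : Fin t → Type*} (f : ∀ i, β i → ℂ)
    (hf : ∀ i, Summable fun b => ‖f i b‖) :
    (Summable fun x : ∀ i, β i => ‖∏ i, f i (x i)‖) ∧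
      ∑' x : ∀ i, β i, ∏ i, f i (x i) = ∏ i, ∑' b, f i b := by
  induction t with
  | zero => exact ⟨Summable.of_finite, by simp⟩
  | succ t ih =>
    obtain ⟨hs, ht⟩ := ih (fun i => f i.succ) fun i => hf i.succ
    have key : ∀ p : β 0 × ∀ i : Fin t, β i.succ,
        ∏ i, f i (Fin.consEquiv β p i) = f 0 p.1 * ∏ i : Fin t, f i.succ (p.2 i) := by
      intro p
      simp [Fin.prod_univ_succ, Fin.consEquiv]
    constructor
    · rw [← (Fin.consEquiv β).summable_iff]
      refine ((hf 0).mul_norm hs).congr fun p => ?_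
      exact congrArg norm (key p).symm
    · rw [← (Fin.consEquiv β).tsum_eq, Fin.prod_univ_succ, ← ht,
        tsum_mul_tsum_of_summable_norm (hf 0) hs]
      exact tsum_congr key

theorem tsum_sigma_of_finite {ι : Type*} [Finite ι] {β : ι → Type*} {f : (Σ i, β i) → ℂ}
    (hf : ∀ i, Summable fun b => ‖f ⟨i, b⟩‖) : ∑' x, f x = ∑ᶠ i, ∑' b, f ⟨i, b⟩ := by
  have hs : Summable fun x => ‖f x‖ :=
    (summable_sigma_of_nonneg fun _ => norm_nonneg _).mpr ⟨hf, Summable.of_finite⟩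
  rw [Summable.tsum_sigma' (fun i => (hf i).of_norm) hs.of_norm, tsum_eq_finsum (Set.toFinite _)]

theorem summable_norm_exp_quadratic {k : ℕ} (hk : 0 < k) {τ : ℂ} (hτ : 0 < τ.im) (z : ℂ) :
    Summable fun b : ℤ => ‖Complex.exp ((Real.pi : ℂ) * Complex.I * τ * (b : ℂ) ^ 2 / (k : ℂ)
      + 2 * (Real.pi : ℂ) * Complex.I * z * (b : ℂ))‖ := by
  have hk' : 0 < (τ / (k : ℂ)).im := by
    rw [Complex.div_natCast_im]
    positivity
  refine ((summable_jacobiTheta₂_term_iff z (τ / (k : ℂ))).mpr hk').norm.congr fun b => ?_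
  rw [jacobiTheta₂_term]
  congr 2
  ring

section Averaging

variable {n : ℕ} {H : Subgroup (Equiv.Perm (Fin n))}

theorem finsum_mem_subgroup_eq_sum {M : Type*} [AddCommMonoid M] [Fintype H]
    (F : Equiv.Perm (Fin n) → M) :
    ∑ᶠ h ∈ (H : Set (Equiv.Perm (Fin n))), F h = ∑ h : H, F h := by
  rw [← finsum_set_coe_eq_finsum_mem]
  exact finsum_eq_sum_of_fintype _

theorem finsum_mem_orbit_invariant {M : Type*} [AddCommMonoid M] (v : Fin n → M)
    {g : Equiv.Perm (Fin n)} (hg : g ∈ H) (i : Fin n) :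
    ∑ᶠ h ∈ (H : Set (Equiv.Perm (Fin n))), v (h⁻¹ (g i)) =
      ∑ᶠ h ∈ (H : Set (Equiv.Perm (Fin n))), v (h⁻¹ i) := by
  classical
  rw [finsum_mem_subgroup_eq_sum fun h => v (h⁻¹ (g i)),
    finsum_mem_subgroup_eq_sum fun h => v (h⁻¹ i)]
  refine Fintype.sum_equiv (Equiv.mulLeft (⟨g, hg⟩ : H)⁻¹) _ _ fun h => ?_
  simp

theorem finsum_mem_of_fixed {M : Type*} [Semiring M] {v : Fin n → M}
    (hv : ∀ h ∈ H, ∀ i, v (h i) = v i) (i : Fin n) :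
    ∑ᶠ h ∈ (H : Set (Equiv.Perm (Fin n))), v (h⁻¹ i) = (Nat.card H : M) * v i := by
  classical
  rw [finsum_mem_subgroup_eq_sum fun h => v (h⁻¹ i),
    Finset.sum_congr rfl fun (h : H) _ => hv _ (H.inv_mem h.2) i]
  simp [Nat.card_eq_fintype_card]

theorem thetaR_fixed (v : Fin n → ℝ) : ∀ h ∈ H, ∀ i, thetaR H v (h i) = thetaR H v i := by
  intro h hh i
  simp only [thetaR, finsum_mem_orbit_invariant v hh i]

theorem thetaR_of_fixed {v : Fin n → ℝ} (hv : ∀ h ∈ H, ∀ i, v (h i) = v i) :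
    thetaR H v = v := by
  funext i
  have : (Nat.card H : ℝ) ≠ 0 := Nat.cast_ne_zero.mpr Nat.card_pos.ne'
  simp only [thetaR, finsum_mem_of_fixed hv]
  field_simp

theorem thetaR_image_eq (Λ : Set (Fin n → ℝ)) :
    thetaR H '' {v ∈ Λ | thetaR H v ∈ Λ} = {v ∈ Λ | ∀ h ∈ H, ∀ i, v (h i) = v i} := by
  ext w
  constructor
  · rintro ⟨v, ⟨-, hv⟩, rfl⟩
    exact ⟨hv, thetaR_fixed v⟩
  · rintro ⟨hw, hfix⟩
    have h := thetaR_of_fixed hfix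
    exact ⟨w, ⟨hw, by rwa [h]⟩, h⟩

theorem thetaZ_image_eq {k : ℕ} (hk : Nat.Coprime (Nat.card H) k)
    (C : Submodule (ZMod k) (Fin n → ZMod k)) (hC : ∀ c ∈ C, ∀ h ∈ H, pAct h c ∈ C) :
    thetaZ k H '' (C : Set (Fin n → ZMod k)) = {c | c ∈ C ∧ ∀ h ∈ H, ∀ i, c (h i) = c i} := by
  classical
  ext w
  constructor
  · rintro ⟨c, hc, rfl⟩
    constructor
    · have : thetaZ k H c =
        Ring.inverse (Nat.card H : ZMod k) • ∑ h : H, pAct (h : Equiv.Perm _) c := by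
        funext i
        simp only [thetaZ, finsum_mem_subgroup_eq_sum fun h => c (h⁻¹ i), pAct, Pi.smul_apply,
          Finset.sum_apply, smul_eq_mul]
      rw [this]
      exact C.smul_mem _ (C.sum_mem fun h _ => hC c hc h h.2)
    · intro h hh i
      simp only [thetaZ, finsum_mem_orbit_invariant c hh i]
  · rintro ⟨hw, hfix⟩
    refine ⟨w, hw, ?_⟩
    funext i
    simp only [thetaZ, finsum_mem_of_fixed hfix]
    exact Ring.inverse_mul_cancel_left _ _ ((ZMod.isUnit_iff_coprime _ _).mpr hk)

end Averaging

theorem summable_norm_and_tsum_prod_exp {k : ℕ} (hk : 0 < k) {t : ℕ} (T : Finset (Fin t)) {τ : ℂ}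
    (hτ : 0 < τ.im) (z : ℂ) (a : Fin t → ZMod k) :
    (Summable fun x : ∀ i, {b : ℤ // (b : ZMod k) = a i} =>
      ‖∏ i, Complex.exp ((Real.pi : ℂ) * Complex.I * τ * ((x i : ℤ) : ℂ) ^ 2 / (k : ℂ)
        + 2 * (Real.pi : ℂ) * Complex.I * (if i ∈ T then 0 else z) * ((x i : ℤ) : ℂ))‖) ∧
    ∑' x : ∀ i, {b : ℤ // (b : ZMod k) = a i},
      ∏ i, Complex.exp ((Real.pi : ℂ) * Complex.I * τ * ((x i : ℤ) : ℂ) ^ 2 / (k : ℂ)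
        + 2 * (Real.pi : ℂ) * Complex.I * (if i ∈ T then 0 else z) * ((x i : ℤ) : ℂ)) =
      (∏ i ∈ T, psiA k τ (a i)) * ∏ i ∈ Tᶜ, phiA k τ z (a i) := by
  obtain ⟨hs, ht⟩ := summable_norm_and_tsum_pi_prod
    (fun i (b : {b : ℤ // (b : ZMod k) = a i}) =>
      Complex.exp ((Real.pi : ℂ) * Complex.I * τ * ((b : ℤ) : ℂ) ^ 2 / (k : ℂ)
        + 2 * (Real.pi : ℂ) * Complex.I * (if i ∈ T then 0 else z) * ((b : ℤ) : ℂ)))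
    (fun i => (summable_norm_exp_quadratic hk hτ (if i ∈ T then 0 else z)).subtype _)
  refine ⟨hs, ht.trans ?_⟩
  rw [← Finset.prod_mul_prod_compl T]
  congr 1
  · refine Finset.prod_congr rfl fun i hi => ?_
    simp [hi, psiA]
  · refine Finset.prod_congr rfl fun i hi => ?_
    simp [Finset.mem_compl.mp hi, phiA]

/-- Integer lifts, orbit by orbit, of the codewords in `S`. -/
abbrev OrbitLift {n t k : ℕ} (rep : Fin t → Fin n) (S : Set (Fin n → ZMod k)) : Type :=
  (c : S) × ∀ i, {b : ℤ // (b : ZMod k) = c.1 (rep i)}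

theorem cjH_psiA_phiA_eq_tsum {n t k : ℕ} (hk : 0 < k) (rep : Fin t → Fin n)
    (T : Finset (Fin t)) (S : Set (Fin n → ZMod k)) {τ : ℂ} (hτ : 0 < τ.im) (z : ℂ) :
    cjH rep T S (psiA k τ) (phiA k τ z) = ∑' e : OrbitLift rep S,
      ∏ i, Complex.exp ((Real.pi : ℂ) * Complex.I * τ * ((e.2 i : ℤ) : ℂ) ^ 2 / (k : ℂ)
        + 2 * (Real.pi : ℂ) * Complex.I * (if i ∈ T then 0 else z) * ((e.2 i : ℤ) : ℂ)) := by
  have : NeZero k := ⟨hk.ne'⟩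
  have hprod := fun c : S => summable_norm_and_tsum_prod_exp hk T hτ z fun i => c.1 (rep i)
  rw [cjH, ← finsum_set_coe_eq_finsum_mem]
  refine Eq.trans ?_ (tsum_sigma_of_finite fun c => ?_).symm
  · exact finsum_congr fun c => (hprod c).2.symm
  · exact (hprod c).1

section Orbits

variable {n t : ℕ} {H : Subgroup (Equiv.Perm (Fin n))} {rep : Fin t → Fin n}

theorem exists_orbit_index (hrep : ∀ j : Fin n, ∃! i : Fin t, j ∈ orbSet H (rep i)) :
    ∃ orb : Fin n → Fin t, ∀ j i, j ∈ orbSet H (rep i) ↔ orb j = i := by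
  choose orb h₁ h₂ using hrep
  exact ⟨orb, fun j i => ⟨fun h => (h₂ j i h).symm, fun h => h ▸ h₁ j⟩⟩

variable {orb : Fin n → Fin t}

theorem orbit_index_rep (horb : ∀ j i, j ∈ orbSet H (rep i) ↔ orb j = i)
    (i : Fin t) : orb (rep i) = i :=
  (horb _ _).mp ⟨1, H.one_mem, rfl⟩

theorem orbit_index_apply (horb : ∀ j i, j ∈ orbSet H (rep i) ↔ orb j = i)
    {h : Equiv.Perm (Fin n)} (hh : h ∈ H) (j : Fin n) :
    orb (h j) = orb j := by
  obtain ⟨g, hg, hgj⟩ := (horb j (orb j)).mpr rfl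
  exact (horb _ _).mp ⟨h * g, H.mul_mem hh hg, by simp [hgj]⟩

theorem apply_rep_orbit_index (horb : ∀ j i, j ∈ orbSet H (rep i) ↔ orb j = i)
    {α : Type*} {v : Fin n → α}
    (hv : ∀ h ∈ H, ∀ i, v (h i) = v i) (j : Fin n) : v (rep (orb j)) = v j := by
  obtain ⟨g, hg, hgj⟩ := (horb j (orb j)).mpr rfl
  rw [← hv g hg, hgj]

theorem yVec_apply (horb : ∀ j i, j ∈ orbSet H (rep i) ↔ orb j = i)
    (k : ℕ) (T : Finset (Fin t)) (j : Fin n) :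
    yVec k H rep T j = if orb j ∈ T then 0 else Real.sqrt k := by
  classical
  simp only [yVec, horb]
  by_cases h : orb j ∈ T <;> simp [h]

theorem exists_bijective_orbitLift (horb : ∀ j i, j ∈ orbSet H (rep i) ↔ orb j = i)
    {k : ℕ} (hk : 0 < k) (C : Set (Fin n → ZMod k)) :
    ∃ m : OrbitLift rep {c | c ∈ C ∧ ∀ h ∈ H, ∀ i, c (h i) = c i} →
        {v ∈ conA k C | ∀ h ∈ H, ∀ i, v (h i) = v i},
      Function.Bijective m ∧
        ∀ e i, (m e : Fin n → ℝ) (rep i) = (Real.sqrt k)⁻¹ * ((e.2 i : ℤ) : ℝ) := by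
  have hsq : (Real.sqrt k)⁻¹ ≠ 0 := inv_ne_zero (Real.sqrt_pos.mpr (Nat.cast_pos.mpr hk)).ne'
  set S : Set (Fin n → ZMod k) := {c | c ∈ C ∧ ∀ h ∈ H, ∀ i, c (h i) = c i}
  have hidx : ∀ (e : OrbitLift rep S) {i j : Fin t}, i = j → (e.2 i : ℤ) = e.2 j := by
    rintro e i _ rfl
    rfl
  have hmod : ∀ e : OrbitLift rep S, (fun j => (((e.2 (orb j) : ℤ) : ZMod k))) = e.1.1 := by
    intro e
    funext j
    rw [(e.2 (orb j)).2, apply_rep_orbit_index horb e.1.2.2]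
  let m : OrbitLift rep S → {v ∈ conA k C | ∀ h ∈ H, ∀ i, v (h i) = v i} := fun e =>
    ⟨fun j => (Real.sqrt k)⁻¹ * ((e.2 (orb j) : ℤ) : ℝ),
      ⟨fun j => e.2 (orb j), by rw [hmod]; exact e.1.2.1, rfl⟩,
      fun h hh i => by simp only [hidx e (orbit_index_apply horb hh i)]⟩
  have hrepval : ∀ e i, (m e : Fin n → ℝ) (rep i) = (Real.sqrt k)⁻¹ * ((e.2 i : ℤ) : ℝ) := by
    intro e i
    simp only [m, hidx e (orbit_index_rep horb i)]
  refine ⟨m, ⟨fun e e' h => ?_, ?_⟩, hrepval⟩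
  · have hval : ∀ i, (e.2 i : ℤ) = e'.2 i := by
      intro i
      have h' := congrFun (congrArg Subtype.val h) (rep i)
      rw [hrepval, hrepval] at h'
      exact_mod_cast mul_left_cancel₀ hsq h'
    have hc : e.1 = e'.1 := by
      apply Subtype.ext
      rw [← hmod e, ← hmod e']
      simp only [hval]
    obtain ⟨c, x⟩ := e
    obtain ⟨c', x'⟩ := e'
    obtain rfl : c = c' := hc
    exact congrArg _ (funext fun i => Subtype.ext (hval i))
  · rintro ⟨_, ⟨x, hx, rfl⟩, hfix⟩
    have hx' : ∀ h ∈ H, ∀ i, x (h i) = x i := by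
      intro h hh i
      exact_mod_cast mul_left_cancel₀ hsq (hfix h hh i)
    refine ⟨⟨⟨fun j => x j, hx, fun h hh i => congrArg _ (hx' h hh i)⟩,
      fun i => ⟨x (rep i), rfl⟩⟩, ?_⟩
    apply Subtype.ext
    funext j
    simp only [m, apply_rep_orbit_index horb hx']

end Orbits

/-- Substituting `ψ_a, φ_a` into the complete `H`-Jacobi polynomial of `Cθ_H`
yields the `H`-Jacobi theta series of `Λ₀(C)θ_H` with respect to `y_T`. -/
theorem stmt15 {n t : ℕ} (k : ℕ) (hk : 2 ≤ k)
    (G H : Subgroup (Equiv.Perm (Fin n))) (hHG : H ≤ G)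
    (hgcd : Nat.gcd (Nat.card H) k = 1)
    (rep : Fin t → Fin n)
    (hrep : ∀ j : Fin n, ∃! i : Fin t, j ∈ orbSet H (rep i))
    (T : Finset (Fin t))
    (C : Submodule (ZMod k) (Fin n → ZMod k))
    (hC : ∀ c ∈ C, ∀ g ∈ G, pAct g c ∈ C)
    (D : Set (Fin n → ℝ))
    (hD : D = thetaR H '' {v ∈ conA k (C : Set (Fin n → ZMod k)) |
        thetaR H v ∈ conA k (C : Set (Fin n → ZMod k))})
    (τ : ℂ) (hτ : 0 < τ.im) (z : ℂ) :
    yVec k H rep T ∈ D ∧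
    cjH rep T (thetaZ k H '' (C : Set (Fin n → ZMod k))) (psiA k τ) (phiA k τ z)
      = ∑' x : D, Complex.exp ((Real.pi : ℂ) * Complex.I * τ *
            ((∑ i : Fin t, (x : Fin n → ℝ) (rep i) * (x : Fin n → ℝ) (rep i) : ℝ) : ℂ)
          + 2 * (Real.pi : ℂ) * Complex.I * z *
            ((∑ i : Fin t, (x : Fin n → ℝ) (rep i) * yVec k H rep T (rep i) : ℝ) : ℂ)) := by
  have hk0 : 0 < k := by omega
  have : NeZero k := ⟨hk0.ne'⟩
  have hkR : (0 : ℝ) < k := by exact_mod_cast hk0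
  have hsq : Real.sqrt k ≠ 0 := (Real.sqrt_pos.mpr hkR).ne'
  have hss : Real.sqrt k * Real.sqrt k = k := Real.mul_self_sqrt hkR.le
  obtain ⟨orb, horb⟩ := exists_orbit_index hrep
  rw [thetaR_image_eq] at hD
  rw [thetaZ_image_eq hgcd C fun c hc h hh => hC c hc h (hHG hh)]
  subst hD
  refine ⟨⟨⟨fun j => if orb j ∈ T then 0 else k, ?_, ?_⟩, ?_⟩, ?_⟩
  · have hz : (fun j => (((if orb j ∈ T then 0 else k : ℤ)) : ZMod k)) = 0 := by
      funext j
      by_cases h : orb j ∈ T <;> simp [h]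
    simp only [hz]
    exact C.zero_mem
  · funext j
    rw [yVec_apply horb]
    by_cases h : orb j ∈ T
    · simp [h]
    · simp only [h, if_false, Int.cast_natCast]
      rw [eq_inv_mul_iff_mul_eq₀ hsq, hss]
  · intro h hh i
    rw [yVec_apply horb, yVec_apply horb, orbit_index_apply horb hh]
  obtain ⟨m, hm, hval⟩ :=
    exists_bijective_orbitLift horb hk0 (C : Set (Fin n → ZMod k))
  rw [← (Equiv.ofBijective m hm).tsum_eq]
  have hterm : ∀ e, Complex.exp ((Real.pi : ℂ) * Complex.I * τ *
            ((∑ i : Fin t, (m e : Fin n → ℝ) (rep i) * (m e : Fin n → ℝ) (rep i) : ℝ) : ℂ)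
          + 2 * (Real.pi : ℂ) * Complex.I * z *
            ((∑ i : Fin t, (m e : Fin n → ℝ) (rep i) * yVec k H rep T (rep i) : ℝ) : ℂ)) =
      ∏ i, Complex.exp ((Real.pi : ℂ) * Complex.I * τ * ((e.2 i : ℤ) : ℂ) ^ 2 / (k : ℂ)
        + 2 * (Real.pi : ℂ) * Complex.I * (if i ∈ T then 0 else z) * ((e.2 i : ℤ) : ℂ)) := by
    intro e
    rw [← Complex.exp_sum, Complex.ofReal_sum, Complex.ofReal_sum, Finset.mul_sum, Finset.mul_sum,
      ← Finset.sum_add_distrib]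
    congr 1
    refine Finset.sum_congr rfl fun i _ => ?_
    have h₁ : (m e : Fin n → ℝ) (rep i) * (m e : Fin n → ℝ) (rep i) =
        ((e.2 i : ℤ) : ℝ) ^ 2 / k := by
      rw [hval, mul_mul_mul_comm, ← mul_inv, hss]
      ring
    have h₂ : (m e : Fin n → ℝ) (rep i) * yVec k H rep T (rep i) =
        if i ∈ T then 0 else ((e.2 i : ℤ) : ℝ) := by
      rw [hval, yVec_apply horb, orbit_index_rep horb]
      by_cases h : i ∈ T
      · simp [h]
      · simp only [h, if_false]
        field_simp
    rw [h₁, h₂]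
    by_cases h : i ∈ T
    · simp [h, mul_div_assoc]
    · simp [h, mul_div_assoc]
  rw [cjH_psiA_phiA_eq_tsum hk0 rep T _ hτ]
  exact (tsum_congr hterm).symm
end
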